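/- arXiv:2202.07961 — 3 statements merged into one kernel-verified Lean document; each statement's English description precedes it below -/
import Mathlib

section
/- Let a_1,…,a_k be pairwise coprime positive integers and d_1,…,d_k positive integers such that, for each i, the polynomial X^{d_i} − a_i is irreducible over ℚ. Then for each i with 1 ≤ i ≤ k, the polynomial X^{d_i} − a_i remains irreducible over the field L_{i−1} = ℚ(d_1√a_1, …, d_{i−1}√a_{i−1}); in particular it is the minimal polynomial of d_i√a_i over L_{i−1}. -/
open Polynomial IntermediateField

theorem aux_minpoly (F : Type*) [Field F] [Algebra F ℝ] (x : ℝ) (n : ℕ) (hn : 0 < n)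
    (c : F) (hx : x ^ n = algebraMap F ℝ c) :
    ∃ b : F, x ^ (minpoly F x).natDegree = algebraMap F ℝ b ∧
      minpoly F x = X ^ (minpoly F x).natDegree - C b := by
  have hint : IsIntegral F x := by
    refine ⟨X ^ n - C c, monic_X_pow_sub_C c hn.ne', ?_⟩
    simp [hx]
  have hmon := minpoly.monic hint
  have hdvd : minpoly F x ∣ X ^ n - C c := minpoly.dvd _ _ (by simp [hx])
  set P := minpoly F x with hP
  have hpos : 0 < P.natDegree := minpoly.natDegree_pos hint
  let Q : ℂ[X] := P.map ((algebraMap ℝ ℂ).comp (algebraMap F ℝ))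
  have hQm : Q.Monic := hmon.map _
  have hQs : Q.Splits := IsAlgClosed.splits Q
  have hQd : Q.natDegree = P.natDegree := hmon.natDegree_map _
  have h0 := hQs.coeff_zero_eq_prod_roots_of_monic hQm
  have hroot : ∀ z ∈ Q.roots, ‖z‖ = |x| := by
    intro z hz
    have hz' : Q.eval z = 0 := (mem_roots'.1 hz).2
    have hd2 : Q ∣ (X ^ n - C c : F[X]).map ((algebraMap ℝ ℂ).comp (algebraMap F ℝ)) := Polynomial.map_dvd _ hdvd
    have h3 := eval_eq_zero_of_dvd_of_eval_eq_zero hd2 hz'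
    have h4 : z ^ n = ((x ^ n : ℝ) : ℂ) := by
      rw [hx]
      simpa [sub_eq_zero] using h3
    have h5 : ‖z‖ ^ n = |x| ^ n := by
      rw [← norm_pow, h4, Complex.norm_real, Real.norm_eq_abs, abs_pow]
    exact (pow_left_inj₀ (norm_nonneg _) (abs_nonneg _) hn.ne').1 h5
  have h1 : |algebraMap F ℝ (P.coeff 0)| = |x| ^ P.natDegree := by
    have e1 : ‖Q.coeff 0‖ = |algebraMap F ℝ (P.coeff 0)| := by
      rw [coeff_map]
      exact Complex.norm_real _
    have e2 : ‖Q.roots.prod‖ = |x| ^ P.natDegree := by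
      rw [← hQd, hQs.natDegree_eq_card_roots]
      have : ‖Q.roots.prod‖ = (Q.roots.map norm).prod := map_multiset_prod (normHom : ℂ →*₀ ℝ) _
      rw [this, Multiset.map_congr rfl hroot]
      simp
    rw [← e1, h0, norm_mul, e2]; simp
  have hb : ∃ b : F, x ^ P.natDegree = algebraMap F ℝ b := by
    rw [← abs_pow] at h1
    rcases abs_eq_abs.1 h1 with h | h
    · exact ⟨_, h.symm⟩
    · exact ⟨-P.coeff 0, by rw [map_neg]; linarith⟩
  obtain ⟨b, hb⟩ := hb
  refine ⟨b, hb, ?_⟩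
  have := minpoly.unique_of_degree_le_degree_minpoly F x (p := X ^ P.natDegree - C b)
    (monic_X_pow_sub_C b hpos.ne') (by simp [hb]) (by
      rw [degree_X_pow_sub_C hpos, ← hP, degree_eq_natDegree hmon.ne_zero])
  exact this.symm

theorem aux_num (a d m N B : ℕ) (hN : 0 < N) (hB : B.Coprime a)
    (u v : ℕ) (huv : u.Coprime v) (hv : 0 < v)
    (h : u ^ (N * d) * B ^ d = a ^ (m * N) * v ^ (N * d)) : u ^ d = a ^ m := by
  have h1 : v ^ (N * d) ∣ B ^ d := by
    refine (Nat.Coprime.pow (N * d) (N * d) huv).symm.dvd_of_dvd_mul_left ?_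
    rw [h]; exact dvd_mul_left _ _
  have h2 : B ^ d ∣ v ^ (N * d) := by
    refine (Nat.Coprime.pow d (m * N) hB).dvd_of_dvd_mul_left ?_
    rw [← h]; exact dvd_mul_left _ _
  have h3 := Nat.dvd_antisymm h1 h2
  rw [← h3] at h
  have h4 := Nat.eq_of_mul_eq_mul_right (by positivity) h
  rw [mul_comm N d, pow_mul, pow_mul] at h4
  exact Nat.pow_left_injective hN.ne' h4

theorem aux_trace (L : IntermediateField ℚ ℝ) [FiniteDimensional ℚ L] (y : L) (n : ℕ) (hn : 0 < n)
    (c : ℚ) (hy : (y : ℝ) ^ n = c) (hne : Algebra.trace ℚ L y ≠ 0) : ∃ q : ℚ, (y : ℝ) = q := by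
  obtain ⟨b, hb, hP⟩ := aux_minpoly ℚ (y : ℝ) n hn c (by simpa using hy)
  by_cases h1 : (minpoly ℚ (y : ℝ)).natDegree = 1
  · exact ⟨b, by simpa [h1] using hb⟩
  exfalso
  apply hne
  have he : minpoly ℚ (y : ℝ) = minpoly ℚ y := minpoly.algebraMap_eq (algebraMap L ℝ).injective y
  have hpos : 0 < (minpoly ℚ (y : ℝ)).natDegree := by
    rw [he]; exact minpoly.natDegree_pos (Algebra.IsIntegral.isIntegral y)
  rw [trace_eq_finrank_mul_minpoly_nextCoeff, ← he]
  have : (minpoly ℚ (y : ℝ)).nextCoeff = 0 := by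
    rw [nextCoeff_of_natDegree_pos hpos]
    conv_lhs => rw [hP]
    rw [natDegree_X_pow_sub_C, coeff_sub, coeff_X_pow, coeff_C, if_neg (by omega), if_neg (by omega)]
    simp
  rw [this]; simp

theorem radical_poly_irreducible_over_tower
    (k : ℕ) (a d : Fin k → ℕ)
    (ha : ∀ i, 0 < a i) (hd : ∀ i, 0 < d i)
    (hcop : ∀ i j, i ≠ j → Nat.Coprime (a i) (a j))
    (hirr : ∀ i, Irreducible (X ^ (d i) - C ((a i : ℚ))))
    (i : Fin k)
    (L : IntermediateField ℚ ℝ)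
    (hL : L = IntermediateField.adjoin ℚ
      {x : ℝ | ∃ j : Fin k, (j : ℕ) < (i : ℕ) ∧ x = (a j : ℝ) ^ ((d j : ℝ)⁻¹)}) :
    Irreducible (X ^ (d i) - C ((a i : ℕ) : L)) ∧
      minpoly L ((a i : ℝ) ^ ((d i : ℝ)⁻¹)) = X ^ (d i) - C ((a i : ℕ) : L) := by
  have hrad : ∀ j, ((a j : ℝ) ^ ((d j : ℝ)⁻¹)) ^ d j = a j := fun j =>
    Real.rpow_inv_natCast_pow (Nat.cast_nonneg _) (hd j).ne'
  have hradpos : ∀ j, 0 < ((a j : ℝ) ^ ((d j : ℝ)⁻¹)) := fun j =>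
    Real.rpow_pos_of_pos (by exact_mod_cast ha j) _
  set S := {x : ℝ | ∃ j : Fin k, (j : ℕ) < (i : ℕ) ∧ x = (a j : ℝ) ^ ((d j : ℝ)⁻¹)} with hS
  have hSint : ∀ x ∈ S, IsIntegral ℚ x := by
    rintro x ⟨j, -, rfl⟩
    exact ⟨X ^ d j - C (a j : ℚ), monic_X_pow_sub_C _ (hd j).ne', by simp [hrad j]⟩
  have hSfin : S.Finite := by
    refine (Set.finite_range fun j : Fin k => (a j : ℝ) ^ ((d j : ℝ)⁻¹)).subset ?_
    rintro x ⟨j, -, rfl⟩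
    exact ⟨j, rfl⟩
  have := hSfin.to_subtype
  have hfd : FiniteDimensional ℚ L := by
    rw [hL]; exact finiteDimensional_adjoin hSint
  have hspan : ∀ z, z ∈ L ↔ z ∈ Submodule.span ℚ (Submonoid.closure S : Set ℝ) := by
    intro z
    rw [← Algebra.adjoin_eq_span, Subalgebra.mem_toSubmodule,
      ← adjoin_toSubalgebra_of_isAlgebraic fun x hx => (hSint x hx).isAlgebraic, hL]
    rfl
  have hmono : ∀ z ∈ Submonoid.closure S, 0 < z ∧ ∃ N B : ℕ, 0 < N ∧ B.Coprime (a i) ∧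
      z ^ N = B := by
    intro z hz
    induction hz using Submonoid.closure_induction with
    | mem x hx =>
      obtain ⟨j, hj, rfl⟩ := hx
      exact ⟨hradpos j, d j, a j, hd j, hcop j i (by rintro rfl; omega), hrad j⟩
    | one => exact ⟨one_pos, 1, 1, one_pos, by simp, by simp⟩
    | mul x y _ _ hx hy =>
      obtain ⟨hx, N, B, hN, hB, hxe⟩ := hx
      obtain ⟨hy, M, D, hM, hD, hye⟩ := hy
      refine ⟨mul_pos hx hy, N * M, B ^ M * D ^ N, Nat.mul_pos hN hM,
        Nat.Coprime.mul_left (hB.pow_left _) (hD.pow_left _), ?_⟩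
      push_cast
      rw [← hxe, ← hye]; ring
  set x := (a i : ℝ) ^ ((d i : ℝ)⁻¹) with hx
  have hxd : x ^ d i = a i := hrad i
  have hxpos : 0 < x := hradpos i
  have key : ∀ m, 0 < m → m < d i → x ^ m ∉ L := by
    intro m hm hmd hmem
    -- some monomial is a rational multiple of x ^ m
    have hex : ∃ z ∈ Submonoid.closure S, ∃ q : ℚ, z * (x ^ m)⁻¹ = q := by
      by_contra! hcon
      have hT : ∀ z (hz : z ∈ Submodule.span ℚ (Submonoid.closure S : Set ℝ)),
          ∀ h : z ∈ L, Algebra.trace ℚ L (⟨z, h⟩ * (⟨x ^ m, hmem⟩ : L)⁻¹) = 0 := by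
        intro z hz
        induction hz using Submodule.span_induction with
        | mem z hz =>
          intro h
          by_contra hne
          obtain ⟨hzpos, N, B, hN, hB, hzB⟩ := hmono z hz
          obtain ⟨q, hq⟩ := aux_trace L _ (N * d i) (Nat.mul_pos hN (hd i))
            ((B : ℚ) ^ d i * (((a i : ℚ)) ^ (m * N))⁻¹) (by
              push_cast
              rw [← hzB, ← hxd, mul_pow, inv_pow]
              congr 1
              · rw [pow_mul]
              · congr 1; ring) hne
          exact hcon z hz q hq
        | zero =>
          intro h
          have : (⟨0, h⟩ : L) = 0 := rfl
          rw [this]; simp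
        | add u v hu hv ihu ihv =>
          intro h
          have : (⟨u + v, h⟩ : L) = ⟨u, (hspan u).2 hu⟩ + ⟨v, (hspan v).2 hv⟩ := rfl
          rw [this, add_mul, map_add, ihu, ihv, add_zero]
        | smul r u hu ihu =>
          intro h
          have : (⟨r • u, h⟩ : L) = r • ⟨u, (hspan u).2 hu⟩ := rfl
          rw [this, smul_mul_assoc, map_smul, ihu, smul_zero]
      have h1 := hT (x ^ m) ((hspan _).1 hmem) hmem
      rw [mul_inv_cancel₀ (by
        intro h0
        exact (pow_pos hxpos m).ne' (congrArg Subtype.val h0))] at h1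
      rw [← map_one (algebraMap ℚ L), Algebra.trace_algebraMap] at h1
      have := Module.finrank_pos (R := ℚ) (M := L)
      simp at h1
      omega
    obtain ⟨z, hz, q, hq⟩ := hex
    obtain ⟨hzpos, N, B, hN, hB, hzB⟩ := hmono z hz
    have hqpos : 0 < q := by
      have : (0 : ℝ) < q := by rw [← hq]; positivity
      exact_mod_cast this
    have hnum : (q.num.natAbs : ℤ) = q.num := by
      rw [Int.natAbs_of_nonneg (Rat.num_pos.2 hqpos).le]
    have hnpos : 0 < q.num.natAbs := Int.natAbs_pos.2 (Rat.num_pos.2 hqpos).ne'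
    have hqe : (q : ℝ) * q.den = q.num.natAbs := by
      have h1 : (q : ℝ) = q.num.natAbs / q.den := by
        have h2 : ((q.num.natAbs : ℕ) : ℝ) = ((q.num : ℤ) : ℝ) := by rw [← hnum]; simp
        rw [h2]; exact Rat.cast_def q
      rw [h1]
      have : (q.den : ℝ) ≠ 0 := by exact_mod_cast q.den_nz
      field_simp
    set u := q.den
    set v := q.num.natAbs
    have hv0 : (v : ℝ) ≠ 0 := by exact_mod_cast hnpos.ne'
    have hzx : z * u = x ^ m * v := by
      have : z = q * x ^ m := by rw [← hq]; field_simp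
      rw [this]
      linear_combination x ^ m * hqe
    have hmain : u ^ d i = a i ^ m := by
      refine aux_num (a i) (d i) m N B hN hB u v q.reduced.symm hnpos ?_
      have h1 : (z * u) ^ (N * d i) = (x ^ m * v) ^ (N * d i) := by rw [hzx]
      have h2 : (u : ℝ) ^ (N * d i) * B ^ d i = a i ^ (m * N) * v ^ (N * d i) := by
        rw [← hzB, ← hxd, ← pow_mul, ← pow_mul]
        rw [mul_pow, mul_pow] at h1
        rw [mul_comm, h1]
        congr 1
        ring
      exact_mod_cast h2
    have hxu : x ^ m = u := by
      have h1 : (x ^ m) ^ d i = (u : ℝ) ^ d i := by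
        rw [← pow_mul, mul_comm, pow_mul, hxd]; exact_mod_cast hmain.symm
      exact (pow_left_inj₀ (by positivity) (by positivity) (hd i).ne').1 h1
    have hmin : X ^ d i - C (a i : ℚ) = minpoly ℚ x :=
      minpoly.eq_of_irreducible_of_monic (hirr i) (by simp [hxd])
        (monic_X_pow_sub_C _ (hd i).ne')
    have hle := minpoly.min ℚ x (monic_X_pow_sub_C (u : ℚ) hm.ne') (by simp [hxu])
    rw [← hmin, degree_X_pow_sub_C (hd i), degree_X_pow_sub_C hm] at hle
    have : d i ≤ m := by exact_mod_cast hle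
    omega
  have hxL : x ^ d i = algebraMap L ℝ ((a i : ℕ) : L) := by rw [hxd]; simp
  have hint : IsIntegral L x :=
    ⟨X ^ d i - C ((a i : ℕ) : L), monic_X_pow_sub_C _ (hd i).ne', by simp [hxd]⟩
  obtain ⟨b, hb, hP⟩ := aux_minpoly L x (d i) (hd i) _ hxL
  have hpos := minpoly.natDegree_pos hint
  have hle : (minpoly L x).natDegree ≤ d i := by
    have hle := minpoly.min L x (monic_X_pow_sub_C ((a i : ℕ) : L) (hd i).ne') (by simp [hxd])
    rw [degree_X_pow_sub_C (hd i)] at hle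
    exact natDegree_le_of_degree_le hle
  have hdeg : (minpoly L x).natDegree = d i := by
    by_contra hne
    exact key _ hpos (by omega) (by rw [hb]; exact b.2)
  rw [hdeg] at hP hb
  have hbe : b = ((a i : ℕ) : L) := (algebraMap L ℝ).injective (by rw [← hb, hxL])
  rw [hbe] at hP
  exact ⟨hP ▸ minpoly.irreducible hint, hP⟩
end

section
/- Let a_1,…,a_k be pairwise coprime positive integers and d_1,…,d_k positive integers such that, for each i, the polynomial X^{d_i} − a_i is irreducible over ℚ. Then the degree of the real radical extension satisfies [ℚ(d_1√a_1, …, d_k√a_k) : ℚ] = d_1 · d_2 ⋯ d_k. -/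
open Polynomial IntermediateField

lemma aux_pow_of_eq (A E F n m e f d D : ℕ) (hA : 0 < A) (hE : 0 < E) (hF : 0 < F) (hn : 0 < n)
    (hm : 0 < m) (hd : 0 < d) (hD : 0 < D) (hAE : Nat.Coprime A E) (hAF : Nat.Coprime A F)
    (hfe : f ≤ e)
    (h : A ^ (e * D) * E * m ^ (d * D) = n ^ (d * D) * (A ^ (f * D) * F)) :
    ∃ c : ℕ, A ^ (e - f) = c ^ d := by
  refine ⟨Nat.floorRoot d (A ^ (e - f)), ?_⟩
  apply Nat.eq_of_factorization_eq (by positivity)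
  · apply pow_ne_zero
    simp [hd.ne', hA.ne']
  intro p
  have key : d ∣ (e - f) * A.factorization p := by
    by_cases hp : p.Prime
    swap
    · simp [Nat.factorization_eq_zero_of_not_prime _ hp]
    by_cases hpA : p ∣ A
    swap
    · simp [Nat.factorization_eq_zero_of_not_dvd hpA]
    have hpE : ¬ p ∣ E := fun h' => hp.one_lt.ne' (Nat.eq_one_of_dvd_coprimes hAE hpA h')
    have hpF : ¬ p ∣ F := fun h' => hp.one_lt.ne' (Nat.eq_one_of_dvd_coprimes hAF hpA h')
    have h2 := congrArg (fun t => Nat.factorization t p) h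
    rw [Nat.factorization_mul (by positivity) (by positivity),
      Nat.factorization_mul (by positivity) (by positivity),
      Nat.factorization_mul (by positivity) (by positivity),
      Nat.factorization_mul (by positivity) (by positivity)] at h2
    simp only [Nat.factorization_pow, Finsupp.add_apply, Finsupp.smul_apply, smul_eq_mul,
      Nat.factorization_eq_zero_of_not_dvd hpE, Nat.factorization_eq_zero_of_not_dvd hpF] at h2
    have h3 : e * A.factorization p + d * m.factorization p
        = d * n.factorization p + f * A.factorization p := by
      apply Nat.eq_of_mul_eq_mul_right hD
      linarith
    obtain ⟨r, rfl⟩ := Nat.exists_eq_add_of_le hfe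
    rw [Nat.add_sub_cancel_left]
    have h4 : r * A.factorization p + d * m.factorization p = d * n.factorization p := by
      linarith
    exact (Nat.dvd_add_left (Dvd.intro _ rfl)).1 (h4 ▸ Dvd.intro _ rfl)
  simp only [Nat.factorization_pow, Nat.factorization_floorRoot, Finsupp.smul_apply, smul_eq_mul]
  simp [Nat.mul_div_cancel' key]

lemma aux_trace_s4 (K : IntermediateField ℚ ℝ) [FiniteDimensional ℚ K] (x : K) (m : ℕ) (hm : 0 < m)
    (q : ℚ) (hx : (x : ℝ) ^ m = q) (hx' : ∀ r : ℚ, (x : ℝ) ≠ r) : Algebra.trace ℚ K x = 0 := by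
  rw [trace_eq_finrank_mul_minpoly_nextCoeff]
  have hint : IsIntegral ℚ x := .of_finite ℚ x
  set r := (minpoly ℚ x).natDegree with hr
  have hrank : Module.finrank ℚ ℚ⟮x⟯ = r := IntermediateField.adjoin.finrank hint
  have hg : (AdjoinSimple.gen ℚ x) ^ m = algebraMap ℚ ℚ⟮x⟯ q := by
    apply Subtype.ext
    apply Subtype.ext
    simpa using hx
  have hN := congrArg (Algebra.norm ℚ) hg
  rw [map_pow, Algebra.norm_algebraMap, hrank] at hN
  have h1 : |((Algebra.norm ℚ (AdjoinSimple.gen ℚ x) : ℚ) : ℝ)| ^ m = |(x : ℝ) ^ r| ^ m := by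
    rw [← abs_pow, ← abs_pow, ← pow_mul, mul_comm, pow_mul, hx]
    exact_mod_cast congrArg (fun t : ℚ => |t|) hN
  have h2 := (pow_left_inj₀ (abs_nonneg _) (abs_nonneg _) hm.ne').1 h1
  obtain ⟨c, hc⟩ : ∃ c : ℚ, (x : ℝ) ^ r = c := by
    rcases abs_eq_abs.1 h2 with h | h
    · exact ⟨_, h.symm⟩
    · exact ⟨-_, by rw [Rat.cast_neg, h, neg_neg]⟩
  have hr0 : 0 < r := minpoly.natDegree_pos hint
  have hr1 : r ≠ 1 := fun h => hx' c (by simpa [h] using hc)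
  have hmp : X ^ r - C c = minpoly ℚ x := by
    apply minpoly.unique_of_degree_le_degree_minpoly
    · exact monic_X_pow_sub_C _ hr0.ne'
    · apply Subtype.ext
      simp [hc]
    · rw [degree_X_pow_sub_C hr0, hr, ← degree_eq_natDegree (minpoly.ne_zero hint)]
  rw [← hmp, nextCoeff_of_natDegree_pos (by rw [natDegree_X_pow_sub_C]; exact hr0),
    natDegree_X_pow_sub_C, coeff_sub, coeff_X_pow, coeff_C, if_neg (by omega), if_neg (by omega)]
  simp

/-- The monomials have irrational ratios. -/
lemma aux_ratio (k : ℕ) (a d : Fin k → ℕ)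
    (ha : ∀ i, 0 < a i) (hd : ∀ i, 0 < d i)
    (hcop : ∀ i j, i ≠ j → Nat.Coprime (a i) (a j))
    (hirr : ∀ i, Irreducible (X ^ (d i) - C ((a i : ℚ))))
    (α : Fin k → ℝ) (hα : ∀ i, 0 < α i) (hαd : ∀ i, α i ^ d i = a i)
    (e f : Fin k → ℕ) (he : ∀ i, e i < d i) (q : ℚ)
    (h : ∏ i, α i ^ e i = q * ∏ i, α i ^ f i) (j : Fin k) : e j ≤ f j := by
  by_contra! hlt
  have hq : 0 < q := by
    have h1 : 0 < ∏ i, α i ^ e i := Finset.prod_pos fun i _ => pow_pos (hα i) _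
    have h2 : 0 < ∏ i, α i ^ f i := Finset.prod_pos fun i _ => pow_pos (hα i) _
    rw [h] at h1
    exact_mod_cast (pos_iff_pos_of_mul_pos h1).2 h2
  have hpow : ∀ g : Fin k → ℕ, (∏ i, α i ^ g i) ^ (∏ i, d i) =
      (a j : ℝ) ^ (g j * ∏ i ∈ Finset.univ.erase j, d i) *
        ((∏ i ∈ Finset.univ.erase j, a i ^ (g i * ∏ l ∈ Finset.univ.erase i, d l) : ℕ) : ℝ) := by
    intro g
    push_cast
    rw [Finset.mul_prod_erase Finset.univ
      (fun i => (a i : ℝ) ^ (g i * ∏ l ∈ Finset.univ.erase i, d l)) (Finset.mem_univ j),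
      ← Finset.prod_pow]
    refine Finset.prod_congr rfl fun i _ => ?_
    rw [← Finset.mul_prod_erase Finset.univ d (Finset.mem_univ i), ← hαd i]
    ring
  have h' := congrArg (fun t => t ^ (∏ i, d i)) h
  simp only [mul_pow] at h'
  rw [hpow, hpow] at h'
  obtain ⟨n, hn⟩ : ∃ n : ℕ, q.num = n := Int.eq_ofNat_of_zero_le (Rat.num_nonneg.2 hq.le)
  have hnpos : 0 < n := by
    have := Rat.num_pos.2 hq
    omega
  have hqn : (q : ℝ) * (q.den : ℝ) = (n : ℝ) := by
    have h1 : q * q.den = (n : ℚ) := by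
      rw [Rat.mul_den_eq_num, hn]
      simp
    exact_mod_cast h1
  have hD : 0 < ∏ i ∈ Finset.univ.erase j, d i := Finset.prod_pos fun i _ => hd i
  have hcp : ∀ g : Fin k → ℕ, Nat.Coprime (a j)
      (∏ i ∈ Finset.univ.erase j, a i ^ (g i * ∏ l ∈ Finset.univ.erase i, d l)) := by
    intro g
    refine Nat.Coprime.prod_right fun i hi => ?_
    exact Nat.Coprime.pow_right _ (hcop j i (Finset.ne_of_mem_erase hi).symm)
  have hps : ∀ g : Fin k → ℕ, 0 <
      (∏ i ∈ Finset.univ.erase j, a i ^ (g i * ∏ l ∈ Finset.univ.erase i, d l)) :=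
    fun g => Finset.prod_pos fun i _ => pow_pos (ha i) _
  obtain ⟨c, hc⟩ := aux_pow_of_eq (a j) _ _ n q.den (e j) (f j) (d j) _
    (ha j) (hps e) (hps f)
    hnpos q.den_pos (hd j) hD (hcp e) (hcp f) hlt.le (by
      rw [Finset.mul_prod_erase Finset.univ d (Finset.mem_univ j)]
      rify
      push_cast at h'
      rw [h', ← hqn, mul_pow]
      ring)
  have hαc : α j ^ (e j - f j) = c := by
    apply (pow_left_inj₀ (pow_pos (hα j) _).le (Nat.cast_nonneg c) (hd j).ne').1
    rw [← pow_mul, mul_comm, pow_mul, hαd]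
    exact_mod_cast hc
  have hmp : X ^ (d j) - C (a j : ℚ) = minpoly ℚ (α j) :=
    minpoly.eq_of_irreducible_of_monic (hirr j) (by simp [hαd]) (monic_X_pow_sub_C _ (hd j).ne')
  have hle := minpoly.min ℚ (α j) (p := X ^ (e j - f j) - C (c : ℚ))
    (monic_X_pow_sub_C _ (by omega)) (by simp [hαc])
  rw [← hmp, degree_X_pow_sub_C (hd j), degree_X_pow_sub_C (by omega)] at hle
  have := he j
  have : d j ≤ e j - f j := by exact_mod_cast hle
  omega

/-- If `a₁,…,a_k` are pairwise coprime positive integers and each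
`X ^ dᵢ - aᵢ` is irreducible over `ℚ`, then
`[ℚ(ᵈ¹√a₁, …, ᵈᵏ√a_k) : ℚ] = d₁ ⋯ d_k`. -/
theorem finrank_radical_extension
    (k : ℕ) (a d : Fin k → ℕ)
    (ha : ∀ i, 0 < a i) (hd : ∀ i, 0 < d i)
    (hcop : ∀ i j, i ≠ j → Nat.Coprime (a i) (a j))
    (hirr : ∀ i, Irreducible (X ^ (d i) - C ((a i : ℚ)))) :
    Module.finrank ℚ
        (IntermediateField.adjoin ℚ
          (Set.range fun i : Fin k => (a i : ℝ) ^ ((d i : ℝ)⁻¹))) =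
      ∏ i : Fin k, d i := by
  set α : Fin k → ℝ := fun i => (a i : ℝ) ^ ((d i : ℝ)⁻¹) with hαdef
  have hα : ∀ i, 0 < α i := fun i => Real.rpow_pos_of_pos (by exact_mod_cast ha i) _
  have hαd : ∀ i, α i ^ d i = a i := fun i =>
    Real.rpow_inv_natCast_pow (Nat.cast_nonneg _) (hd i).ne'
  have hint : ∀ x ∈ Set.range α, IsIntegral ℚ x := by
    rintro _ ⟨i, rfl⟩
    refine IsIntegral.of_pow (hd i) ?_
    rw [hαd]
    have := isIntegral_algebraMap (R := ℚ) (A := ℝ) (x := (a i : ℚ))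
    simpa using this
  set K := IntermediateField.adjoin ℚ (Set.range α) with hK
  have : FiniteDimensional ℚ K := finiteDimensional_adjoin hint
  have hmem : ∀ i, α i ∈ K := fun i => subset_adjoin _ _ ⟨i, rfl⟩
  let x : Fin k → K := fun i => ⟨α i, hmem i⟩
  let b : ((i : Fin k) → Fin (d i)) → K := fun e => ∏ i, x i ^ (e i : ℕ)
  have hbc : ∀ e, (b e : ℝ) = ∏ i, α i ^ (e i : ℕ) := by
    intro e
    simp [b, x]
  have hbpos : ∀ e, 0 < (b e : ℝ) := fun e => by
    rw [hbc]
    exact Finset.prod_pos fun i _ => pow_pos (hα i) _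
  have hb0 : ∀ e, b e ≠ 0 := fun e h => by
    have := hbpos e
    simp [h] at this
  have hbD : ∀ e, ∃ q : ℚ, (b e : ℝ) ^ (∏ i, d i) = q := by
    intro e
    refine ⟨∏ i, (a i : ℚ) ^ (e i * ∏ l ∈ Finset.univ.erase i, d l), ?_⟩
    rw [hbc, ← Finset.prod_pow]
    push_cast
    refine Finset.prod_congr rfl fun i _ => ?_
    rw [← Finset.mul_prod_erase Finset.univ d (Finset.mem_univ i), ← hαd i]
    ring
  have hDpos : 0 < ∏ i, d i := Finset.prod_pos fun i _ => hd i
  have htr : ∀ e f, e ≠ f → Algebra.trace ℚ K (b e * (b f)⁻¹) = 0 := by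
    intro e f hef
    obtain ⟨q₁, h₁⟩ := hbD e
    obtain ⟨q₂, h₂⟩ := hbD f
    refine aux_trace_s4 K _ (∏ i, d i) hDpos (q₁ * q₂⁻¹) ?_ ?_
    · push_cast
      rw [mul_pow, inv_pow, h₁, h₂]
    · intro r hr
      push_cast at hr
      have hr' : (b e : ℝ) = r * b f := by
        rw [← hr, mul_assoc, inv_mul_cancel₀ (hbpos f).ne', mul_one]
      have hr'' : (b f : ℝ) = (r⁻¹ : ℚ) * b e := by
        have hr0 : (r : ℝ) ≠ 0 := fun h0 => (hbpos e).ne' (by rw [hr', h0, zero_mul])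
        rw [hr']
        push_cast
        field_simp
      rw [hbc, hbc] at hr' hr''
      apply hef
      funext j
      apply Fin.ext
      exact le_antisymm
        (aux_ratio k a d ha hd hcop hirr α hα hαd (fun i => e i) (fun i => f i)
          (fun i => (e i).2) r hr' j)
        (aux_ratio k a d ha hd hcop hirr α hα hαd (fun i => f i) (fun i => e i)
          (fun i => (f i).2) r⁻¹ hr'' j)
  have hli : LinearIndependent ℚ b := by
    rw [Fintype.linearIndependent_iff]
    intro g hg f
    have h1 := congrArg (fun t => Algebra.trace ℚ K (t * (b f)⁻¹)) hg
    simp only [Finset.sum_mul, map_sum, zero_mul, map_zero, smul_mul_assoc, map_smul] at h1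
    rw [Finset.sum_eq_single f (fun e _ hef => by rw [htr e f hef, smul_zero])
      (fun h => absurd (Finset.mem_univ f) h), mul_inv_cancel₀ (hb0 f)] at h1
    have h2 : Algebra.trace ℚ K 1 = (Module.finrank ℚ K : ℚ) := by
      have := Algebra.trace_algebraMap (R := ℚ) (S := K) 1
      simpa using this
    rw [h2, smul_eq_mul] at h1
    have h3 : (Module.finrank ℚ K : ℚ) ≠ 0 := by
      exact_mod_cast (Module.finrank_pos (R := ℚ) (M := K)).ne'
    exact (mul_eq_zero.1 h1).resolve_right h3
  have hli' : LinearIndependent ℚ (fun e => (b e : ℝ)) :=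
    hli.map' K.val.toLinearMap (LinearMap.ker_eq_bot.2 K.val.injective)
  have hspan : Subalgebra.toSubmodule K.toSubalgebra
      = Submodule.span ℚ (Set.range fun e => (b e : ℝ)) := by
    apply le_antisymm
    · have hKA : K.toSubalgebra = Algebra.adjoin ℚ (Set.range α) :=
        adjoin_toSubalgebra_of_isAlgebraic (fun x hx => (hint x hx).isAlgebraic)
      rw [hKA, Algebra.adjoin_eq_span, Submodule.span_le]
      intro y hy
      obtain ⟨n, rfl⟩ := Submonoid.exists_of_mem_closure_range _ _ hy
      have : ∏ i, α i ^ n i = (∏ i, (a i : ℚ) ^ (n i / d i)) •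
          (b (fun i => ⟨n i % d i, Nat.mod_lt _ (hd i)⟩) : ℝ) := by
        rw [hbc, Rat.smul_def]
        push_cast
        rw [← Finset.prod_mul_distrib]
        refine Finset.prod_congr rfl fun i _ => ?_
        rw [← hαd i, ← pow_mul, ← pow_add, Nat.div_add_mod]
      rw [this]
      exact Submodule.smul_mem _ _ (Submodule.subset_span ⟨_, rfl⟩)
    · rw [Submodule.span_le]
      rintro _ ⟨e, rfl⟩
      exact (b e).2
  have hfin := finrank_span_eq_card hli'
  rw [← hspan] at hfin
  rw [Fintype.card_pi] at hfin
  simpa using hfin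
end

section
/- Let a_1,…,a_k be pairwise coprime positive integers and d_1,…,d_k positive integers such that, for each i, the polynomial X^{d_i} − a_i is irreducible over ℚ, and let K ⊆ ℂ be the splitting field of ∏_{i=1}^k (X^{d_i} − a_i) over ℚ. Then the Galois group Gal(K/ℚ) acts transitively on the set 𝒮 = { (α_1,…,α_k) ∈ K^k : α_1^{d_1} = a_1 ∧ ⋯ ∧ α_k^{d_k} = a_k }: for any two tuples τ_1, τ_2 ∈ 𝒮 there exists an automorphism g ∈ Gal(K/ℚ) with g applied componentwise to τ_1 equal to τ_2. -/
open Polynomial IntermediateField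

lemma aux_nextCoeff (r : ℝ) (hr : 0 < r) (D n : ℕ) (hD : 0 < D) (h : r ^ D = n)
    (hq : ∀ q : ℚ, r ≠ q) : (minpoly ℚ (r : ℂ)).nextCoeff = 0 := by
  have hc : (r : ℂ) ^ D = n := by exact_mod_cast h
  have hroot : aeval (r : ℂ) (X ^ D - C (n : ℚ)) = 0 := by simp [hc]
  have hint : IsIntegral ℚ (r : ℂ) := ⟨X ^ D - C (n : ℚ), monic_X_pow_sub_C _ hD.ne', hroot⟩
  set p := minpoly ℚ (r : ℂ) with hp
  have hpm : p.Monic := minpoly.monic hint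
  have hdvd : p ∣ X ^ D - C (n : ℚ) := minpoly.dvd _ _ hroot
  have hsp : (p.map (algebraMap ℚ ℂ)).Splits := IsAlgClosed.splits _
  have h0 := hsp.coeff_zero_eq_prod_roots_of_monic (hpm.map _)
  have hroots : ∀ z ∈ (p.map (algebraMap ℚ ℂ)).roots, ‖z‖ = r := by
    intro z hz
    have hz' : aeval z p = 0 := by
      have := (mem_roots'.1 hz).2
      simpa [IsRoot.def, eval_map_algebraMap] using this
    have h1 : aeval z (X ^ D - C (n : ℚ)) = 0 := by
      obtain ⟨s, hs⟩ := hdvd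
      rw [hs, map_mul, hz', zero_mul]
    have h2 : z ^ D = n := by simpa [sub_eq_zero] using h1
    have h3 : ‖z‖ ^ D = r ^ D := by rw [← norm_pow, h2, h]; simp
    exact (pow_left_inj₀ (norm_nonneg _) hr.le hD.ne').1 h3
  have hcard : (p.map (algebraMap ℚ ℂ)).roots.card = p.natDegree := by
    rw [← hsp.natDegree_eq_card_roots, natDegree_map]
  have hn : ‖(p.map (algebraMap ℚ ℂ)).roots.prod‖ = r ^ p.natDegree := by
    have : ((p.map (algebraMap ℚ ℂ)).roots.map (fun z => ‖z‖)) = Multiset.replicate p.natDegree r := by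
      rw [Multiset.eq_replicate]
      refine ⟨by rw [Multiset.card_map, hcard], ?_⟩
      intro b hb
      obtain ⟨z, hz, rfl⟩ := Multiset.mem_map.1 hb
      exact hroots z hz
    have h5 := Multiset.prod_hom (p.map (algebraMap ℚ ℂ)).roots (normHom : ℂ →*₀ ℝ)
    have h6 : (normHom : ℂ →*₀ ℝ) (p.map (algebraMap ℚ ℂ)).roots.prod = r ^ p.natDegree := by
      rw [← h5]
      change ((p.map (algebraMap ℚ ℂ)).roots.map (fun z => ‖z‖)).prod = _
      rw [this, Multiset.prod_replicate]
    exact h6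
  have hb : r ^ p.natDegree = ((|p.coeff 0| : ℚ) : ℝ) := by
    have h7 := congrArg norm h0
    rw [norm_mul, hn] at h7
    simp at h7
    rw [← h7]
    simp
  set m := p.natDegree with hm
  have hm2 : 2 ≤ m := by
    have hpos : 0 < m := minpoly.natDegree_pos hint
    by_contra hlt
    have h1 : m = 1 := by omega
    rw [h1, pow_one] at hb
    exact hq _ hb
  have hdvd2 : p ∣ X ^ m - C (|p.coeff 0|) := by
    apply minpoly.dvd
    have : (r : ℂ) ^ m = ((|p.coeff 0| : ℚ) : ℂ) := by
      have := congrArg (fun x : ℝ => (x : ℂ)) hb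
      simp only [Complex.ofReal_pow, Complex.ofReal_ratCast] at this
      exact this
    simp only [map_sub, map_pow, aeval_X, aeval_C, this]
    simp
  have heq : p = X ^ m - C (|p.coeff 0|) := by
    refine (eq_of_monic_of_dvd_of_natDegree_le hpm (monic_X_pow_sub_C _ (by omega)) hdvd2 ?_).symm
    rw [natDegree_X_pow_sub_C]
  have hnd : p.natDegree ≠ 0 := by omega
  rw [nextCoeff_of_natDegree_pos (by omega)]
  rw [← hm, heq]
  rw [coeff_sub, coeff_X_pow, coeff_C, if_neg (by omega), if_neg (by omega), sub_zero]

lemma aux_irrational (k : ℕ) (a d e : Fin k → ℕ)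
    (hd : ∀ i, 0 < d i)
    (hcop : ∀ i j, i ≠ j → Nat.Coprime (a i) (a j))
    (hirr : ∀ i, Irreducible (X ^ (d i) - C ((a i : ℚ))))
    (r : Fin k → ℝ) (hr : ∀ i, 0 < r i) (hra : ∀ i, r i ^ d i = a i)
    (he : ∀ i, e i < d i) (i : Fin k) (hi : e i ≠ 0) (q : ℚ) : ∏ j, r j ^ e j ≠ q := by
  intro h
  set D := ∏ j, d j with hDdef
  have hD : 0 < D := Finset.prod_pos fun j _ => hd j
  choose c hc using fun j : Fin k => Finset.dvd_prod_of_mem d (Finset.mem_univ j)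
  have hqD : (q : ℝ) ^ D = ((∏ j, a j ^ (e j * c j) : ℕ) : ℝ) := by
    rw [← h, ← Finset.prod_pow]
    push_cast
    refine Finset.prod_congr rfl fun j _ => ?_
    rw [← hra j, ← pow_mul, ← pow_mul, hDdef, hc j]
    congr 1; ring
  have hqD' : q ^ D = ((∏ j, a j ^ (e j * c j) : ℕ) : ℚ) := by exact_mod_cast hqD
  have hqpos : 0 < q := by
    have : (0:ℝ) < q := by rw [← h]; exact Finset.prod_pos fun j _ => pow_pos (hr j) _
    exact_mod_cast this
  have hqint : IsIntegral ℤ q := by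
    refine ⟨X ^ D - C ((∏ j, a j ^ (e j * c j) : ℕ) : ℤ), monic_X_pow_sub_C _ hD.ne', ?_⟩
    simp only [eval₂_sub, eval₂_X_pow, eval₂_C, hqD']
    simp
  obtain ⟨z, hz⟩ := IsIntegrallyClosed.isIntegral_iff.1 hqint
  have hz' : (z : ℚ) = q := by simpa using hz
  have hzpos : 0 ≤ z := by
    have : (0:ℚ) < z := by rw [hz']; exact hqpos
    exact_mod_cast this.le
  obtain ⟨N, rfl⟩ := Int.eq_ofNat_of_zero_le hzpos
  have hN : N ^ D = ∏ j, a j ^ (e j * c j) := by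
    rw [← hz'] at hqD'
    exact_mod_cast hqD'
  rw [← Finset.mul_prod_erase _ _ (Finset.mem_univ i)] at hN
  have hcp : Nat.Coprime (a i ^ (e i * c i))
      (∏ j ∈ Finset.univ.erase i, a j ^ (e j * c j)) := by
    refine Nat.Coprime.prod_right fun j hj => ?_
    exact Nat.Coprime.pow _ _ (hcop i j (Finset.ne_of_mem_erase hj).symm)
  obtain ⟨b, hb⟩ := exists_eq_pow_of_mul_eq_pow (by
    rw [Nat.isUnit_iff]; exact hcp) hN.symm
  have hrb : r i ^ e i = b := by
    have : (r i ^ e i) ^ D = (b : ℝ) ^ D := by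
      have h1 : ((a i : ℝ)) ^ (e i * c i) = (b : ℝ) ^ D := by exact_mod_cast hb
      rw [← h1, ← hra i, ← pow_mul, ← pow_mul, hDdef, hc i]
      congr 1; ring
    exact (pow_left_inj₀ (pow_pos (hr i) _).le (Nat.cast_nonneg _) hD.ne').1 this
  have hroot : aeval (r i) (X ^ (d i) - C ((a i : ℚ))) = 0 := by simp [hra i]
  have hmin := minpoly.eq_of_irreducible_of_monic (hirr i) hroot (monic_X_pow_sub_C _ (hd i).ne')
  have hroot2 : aeval (r i) (X ^ (e i) - C ((b : ℚ))) = 0 := by simp [hrb]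
  have hdv := minpoly.dvd ℚ _ hroot2
  rw [← hmin] at hdv
  have := natDegree_le_of_dvd hdv (monic_X_pow_sub_C _ hi).ne_zero
  rw [natDegree_X_pow_sub_C, natDegree_X_pow_sub_C] at this
  exact absurd (he i) (by omega)

/-- The Galois group of the splitting field `K ⊆ ℂ` of
`∏ i, (X ^ dᵢ - aᵢ)` over `ℚ` acts transitively on the set of `k`-tuples
`(α₁,…,α_k) ∈ K^k` with `αᵢ ^ dᵢ = aᵢ` for all `i`. -/
theorem galois_group_acts_jointly_transitively
    (k : ℕ) (a d : Fin k → ℕ)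
    (ha : ∀ i, 0 < a i) (hd : ∀ i, 0 < d i)
    (hcop : ∀ i j, i ≠ j → Nat.Coprime (a i) (a j))
    (hirr : ∀ i, Irreducible (X ^ (d i) - C ((a i : ℚ))))
    (K : IntermediateField ℚ ℂ)
    (hK : K = IntermediateField.adjoin ℚ
      ((∏ i : Fin k, (X ^ (d i) - C ((a i : ℚ)))).rootSet ℂ))
    (τ₁ τ₂ : Fin k → K)
    (h₁ : ∀ i, (τ₁ i) ^ (d i) = ((a i : ℕ) : K))
    (h₂ : ∀ i, (τ₂ i) ^ (d i) = ((a i : ℕ) : K)) :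
    ∃ g : K ≃ₐ[ℚ] K, ∀ i, g (τ₁ i) = τ₂ i := by
  set P : ℚ[X] := ∏ i : Fin k, (X ^ (d i) - C ((a i : ℚ))) with hP
  have hP0 : P ≠ 0 := (monic_prod_of_monic _ _
    fun i _ => monic_X_pow_sub_C _ (hd i).ne').ne_zero
  have hspl : P.IsSplittingField ℚ K := by
    rw [hK]; exact adjoin_rootSet_isSplittingField (IsAlgClosed.splits _)
  have : FiniteDimensional ℚ K := hspl.finiteDimensional K P
  have : Normal ℚ K := Normal.of_isSplittingField P
  have : IsGalois ℚ K := ⟨⟩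
  -- the real roots
  have hex : ∀ i, ∃ r : ℝ, 0 < r ∧ r ^ d i = a i := fun i =>
    ⟨(a i : ℝ) ^ ((d i : ℝ)⁻¹), Real.rpow_pos_of_pos (by exact_mod_cast ha i) _,
      Real.rpow_inv_natCast_pow (Nat.cast_nonneg _) (hd i).ne'⟩
  choose r hr hra using hex
  have hmem : ∀ i, (r i : ℂ) ∈ K := by
    intro i
    rw [hK]
    apply subset_adjoin
    rw [mem_rootSet]
    refine ⟨hP0, ?_⟩
    have h1 : (r i : ℂ) ^ d i = a i := by exact_mod_cast hra i
    rw [hP, map_prod]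
    refine Finset.prod_eq_zero (Finset.mem_univ i) ?_
    simp [h1]
  let α : Fin k → K := fun i => ⟨r i, hmem i⟩
  have hα : ∀ i, (α i) ^ (d i) = ((a i : ℕ) : K) := by
    intro i
    apply Subtype.ext
    have h1 : (r i : ℂ) ^ d i = a i := by exact_mod_cast hra i
    simpa [α] using h1
  have htr : ∀ e : Fin k → ℕ, (∀ i, e i < d i) → (∃ i, e i ≠ 0) →
      ∑ g : K ≃ₐ[ℚ] K, g (∏ i, α i ^ e i) = 0 := by
    rintro e he ⟨i, hi⟩
    rw [← trace_eq_sum_automorphisms, trace_eq_finrank_mul_minpoly_nextCoeff]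
    have hco : ((∏ i, α i ^ e i : K) : ℂ) = ((∏ i, r i ^ e i : ℝ) : ℂ) := by
      have := map_prod K.val (fun i => α i ^ e i) Finset.univ
      simp only [map_pow] at this
      simp only [Complex.ofReal_prod, Complex.ofReal_pow]
      exact this
    have h0 : (minpoly ℚ (∏ i, α i ^ e i : K)).nextCoeff = 0 := by
      rw [← minpoly.algebraMap_eq (B' := ℂ) (algebraMap K ℂ).injective, IntermediateField.algebraMap_apply, hco]
      refine aux_nextCoeff _ (Finset.prod_pos fun j _ => pow_pos (hr j) _) (∏ j, d j)
        (∏ j, a j ^ (e j * ∏ l ∈ Finset.univ.erase j, d l))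
        (Finset.prod_pos fun j _ => hd j) ?_
        (aux_irrational k a d e hd hcop hirr r hr hra he i hi)
      rw [← Finset.prod_pow]
      push_cast
      refine Finset.prod_congr rfl fun j _ => ?_
      rw [← hra j, ← pow_mul, ← pow_mul, ← Finset.mul_prod_erase _ _ (Finset.mem_univ j)]
      congr 1; ring
    rw [h0]; simp
  have key : ∀ τ : Fin k → K, (∀ i, (τ i) ^ (d i) = ((a i : ℕ) : K)) →
      ∃ g : K ≃ₐ[ℚ] K, ∀ i, g (α i) = τ i := by
    intro τ hτ
    have hτ0 : ∀ i, τ i ≠ 0 := by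
      intro i h0
      have := hτ i
      rw [h0, zero_pow (hd i).ne'] at this
      exact (ha i).ne' (by exact_mod_cast this.symm)
    have hsum : ∑ g : K ≃ₐ[ℚ] K, ∏ i, ∑ e ∈ Finset.range (d i), (g (α i) / τ i) ^ e ≠ 0 := by
      have h1 : ∑ g : K ≃ₐ[ℚ] K, ∏ i, ∑ e ∈ Finset.range (d i), (g (α i) / τ i) ^ e =
          ∑ e ∈ Fintype.piFinset (fun i => Finset.range (d i)),
            (∑ g : K ≃ₐ[ℚ] K, g (∏ i, α i ^ e i)) * (∏ i, τ i ^ e i)⁻¹ := by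
        simp_rw [Finset.prod_univ_sum, Finset.sum_mul]
        rw [Finset.sum_comm]
        refine Finset.sum_congr rfl fun e _ => Finset.sum_congr rfl fun g _ => ?_
        simp_rw [div_pow, Finset.prod_div_distrib, map_prod, map_pow, div_eq_mul_inv]
      rw [h1, Finset.sum_eq_single (fun _ => 0)]
      · simp
      · intro e he hne
        rw [htr e (fun i => by simpa using Fintype.mem_piFinset.1 he i)
          (Function.ne_iff.1 hne), zero_mul]
      · intro hn
        exact absurd (Fintype.mem_piFinset.2 fun i => Finset.mem_range.2 (hd i)) hn
    obtain ⟨g, -, hg⟩ := Finset.exists_ne_zero_of_sum_ne_zero hsum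
    refine ⟨g, fun i => ?_⟩
    have hgi := Finset.prod_ne_zero_iff.1 hg i (Finset.mem_univ i)
    by_contra hne
    apply hgi
    have hx : g (α i) / τ i ≠ 1 := by
      rw [Ne, div_eq_one_iff_eq (hτ0 i)]; exact hne
    rw [geom_sum_eq hx, div_pow, ← map_pow, hα, hτ, map_natCast, div_self, sub_self, zero_div]
    exact_mod_cast (ha i).ne'
  obtain ⟨g₁, hg₁⟩ := key τ₁ h₁
  obtain ⟨g₂, hg₂⟩ := key τ₂ h₂
  refine ⟨g₁.symm.trans g₂, fun i => ?_⟩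
  rw [AlgEquiv.trans_apply, ← hg₁, AlgEquiv.symm_apply_apply, hg₂]
end
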